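/- arXiv:1902.01461 — 2 statements merged into one kernel-verified Lean document; each statement's English description precedes it below -/
import Mathlib

section
/- Let T be a finite type, let k ≥ 2 be a natural number, let F be a downward-closed k-extendible system of finsets of T, let w : T → ℝ be strictly positive weights, and let f be the weighted rank function of F with weights w. Then for every decision tree 𝒯 over T, adap(𝒯, f) ≤ 32 · k · log₂ k · alg(𝒯, f). (Theorem 4.3: the adaptivity gap for a weighted rank function of a k-extendible system is at most 32 k log₂ k.) -/
open Finset

/-- A decision tree over a finite type `T`: either a leaf, or a node with a
probability mass function `μ : T → ℝ` and a child tree for each type `t : T`. -/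
inductive DTree (T : Type*) where
  | leaf : DTree T
  | node : (T → ℝ) → (T → DTree T) → DTree T

/-- All distributions appearing in the tree are probability mass functions. -/
def DTree.valid {T : Type*} [Fintype T] : DTree T → Prop
  | .leaf => True
  | .node μ c => (∀ t, 0 ≤ μ t) ∧ (∑ t, μ t) = 1 ∧ ∀ t, (c t).valid

/-- Contraction `f_S(A) = f(S ∪ A) − f(S)`. -/
def contract {T : Type*} [DecidableEq T] (f : Finset T → ℝ) (S : Finset T) :
    Finset T → ℝ :=
  fun A => f (S ∪ A) - f S

/-- Adaptive value: `adap(leaf, f) = 0`,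
`adap(node μ c, f) = E_{I∼μ}[ f({I}) + adap(c(I), f_{{I}}) ]`. -/
noncomputable def adap {T : Type*} [Fintype T] [DecidableEq T] :
    DTree T → (Finset T → ℝ) → ℝ
  | .leaf, _ => 0
  | .node μ c, f => ∑ t, μ t * (f {t} + adap (c t) (contract f {t}))

/-- Random-walk non-adaptive value: `alg(leaf, f) = 0`,
`alg(node μ c, f) = E_{I∼μ} E_{R∼μ}[ f({R}) + alg(c(I), f_{{R}}) ]`. -/
noncomputable def alg {T : Type*} [Fintype T] [DecidableEq T] :
    DTree T → (Finset T → ℝ) → ℝ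
  | .leaf, _ => 0
  | .node μ c, f => ∑ i, ∑ r, μ i * μ r * (f {r} + alg (c i) (contract f {r}))

/-- Downward-closed family of finsets: contains `∅` and all subsets of members. -/
def DownwardClosed {T : Type*} (F : Finset (Finset T)) : Prop :=
  ∅ ∈ F ∧ ∀ B ∈ F, ∀ A ⊆ B, A ∈ F

/-- `k`-extendible system: for every `A ⊆ B ∈ F` and element `e` with
`A ∪ {e} ∈ F`, some `Z ⊆ B \ A` with `|Z| ≤ k` has `(B \ Z) ∪ {e} ∈ F`. -/
def KExtendible {T : Type*} [DecidableEq T] (k : ℕ) (F : Finset (Finset T)) : Prop :=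
  ∀ A B : Finset T, A ⊆ B → B ∈ F → ∀ e : T, A ∪ {e} ∈ F →
    ∃ Z ⊆ B \ A, Z.card ≤ k ∧ (B \ Z) ∪ {e} ∈ F

/-- Unweighted rank function `f(A) = max_{B ∈ F} |A ∩ B|` (as a real number). -/
noncomputable def urank {T : Type*} [DecidableEq T] (F : Finset (Finset T))
    (A : Finset T) : ℝ :=
  ((F.sup fun B => (A ∩ B).card : ℕ) : ℝ)

/-- Weighted rank function `f(A) = max_{B ∈ F} Σ_{t ∈ A ∩ B} w(t)`
(for a nonempty family; any downward-closed family is nonempty). -/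
noncomputable def wrank {T : Type*} [DecidableEq T] (F : Finset (Finset T))
    (w : T → ℝ) (A : Finset T) : ℝ :=
  if h : F.Nonempty then F.sup' h (fun B => ∑ t ∈ A ∩ B, w t) else 0

open Classical in
/-- Unweighted class rank function
`f_j(A) = max_{B ∈ F} |{t ∈ A ∩ B : 2^{j−1} < w(t) ≤ 2^j}|` (as a real number). -/
noncomputable def classRank {T : Type*} [DecidableEq T] (F : Finset (Finset T))
    (w : T → ℝ) (j : ℤ) (A : Finset T) : ℝ :=
  ((F.sup fun B =>
      ((A ∩ B).filter fun t => (2:ℝ)^(j-1) < w t ∧ w t ≤ (2:ℝ)^j).card : ℕ) : ℝ)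

set_option linter.unusedSectionVars false

namespace AdapGap

variable {T : Type*} [Fintype T] [DecidableEq T]

/-- Joint expectation over the path `I` and the independent copies `R`. -/
noncomputable def J : DTree T → (List (T × T) → ℝ) → ℝ
  | .leaf, Φ => Φ []
  | .node μ c, Φ => ∑ i, ∑ r, μ i * μ r * J (c i) (fun l => Φ ((i, r) :: l))

lemma J_mono (τ : DTree T) (h : τ.valid) (Φ Ψ : List (T × T) → ℝ) (hle : ∀ l, Φ l ≤ Ψ l) :
    J τ Φ ≤ J τ Ψ := by
  induction τ generalizing Φ Ψ with
  | leaf => exact hle _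
  | node μ c ih =>
    obtain ⟨h0, h1, h2⟩ := h
    simp only [J]
    refine Finset.sum_le_sum fun i _ => Finset.sum_le_sum fun r _ => ?_
    exact mul_le_mul_of_nonneg_left (ih i (h2 i) _ _ fun l => hle _)
      (mul_nonneg (h0 i) (h0 r))

lemma J_add (τ : DTree T) (Φ Ψ : List (T × T) → ℝ) :
    J τ (fun l => Φ l + Ψ l) = J τ Φ + J τ Ψ := by
  induction τ generalizing Φ Ψ with
  | leaf => rfl
  | node μ c ih =>
    simp only [J, ih, mul_add, Finset.sum_add_distrib]

lemma J_mul (τ : DTree T) (a : ℝ) (Φ : List (T × T) → ℝ) :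
    J τ (fun l => a * Φ l) = a * J τ Φ := by
  induction τ generalizing Φ with
  | leaf => rfl
  | node μ c ih =>
    simp only [J, ih, Finset.mul_sum]
    refine Finset.sum_congr rfl fun i _ => Finset.sum_congr rfl fun r _ => ?_
    ring

lemma dsum (μ : T → ℝ) (h1 : ∑ t, μ t = 1) (x : T → ℝ) :
    ∑ i, ∑ r, μ i * μ r * x i = ∑ i, μ i * x i := by
  refine Finset.sum_congr rfl fun i _ => ?_
  have : ∀ r, μ i * μ r * x i = μ r * (μ i * x i) := fun r => by ring
  simp only [this, ← Finset.sum_mul, h1, one_mul]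

lemma dsum' (μ : T → ℝ) (h1 : ∑ t, μ t = 1) (x : T → ℝ) :
    ∑ i, ∑ r, μ i * μ r * x r = ∑ i, μ i * x i := by
  rw [Finset.sum_comm, ← dsum μ h1 x]
  refine Finset.sum_congr rfl fun i _ => Finset.sum_congr rfl fun r _ => ?_
  ring

lemma J_const (τ : DTree T) (h : τ.valid) (a : ℝ) : J τ (fun _ => a) = a := by
  induction τ with
  | leaf => rfl
  | node μ c ih =>
    obtain ⟨h0, h1, h2⟩ := h
    simp only [J]
    simp only [fun i => ih i (h2 i)]
    rw [dsum μ h1 (fun _ => a), ← Finset.sum_mul, h1, one_mul]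

lemma J_sub_const (τ : DTree T) (h : τ.valid) (Φ : List (T × T) → ℝ) (a : ℝ) :
    J τ (fun l => Φ l - a) = J τ Φ - a := by
  have := J_add τ Φ (fun _ => -a)
  rw [J_const τ h] at this
  simpa [sub_eq_add_neg] using this

lemma J_sum {ι : Type*} (s : Finset ι) (τ : DTree T) (h : τ.valid)
    (Φ : ι → List (T × T) → ℝ) :
    J τ (fun l => ∑ j ∈ s, Φ j l) = ∑ j ∈ s, J τ (Φ j) := by
  classical
  induction s using Finset.induction_on with
  | empty => simpa using J_const τ h 0
  | insert a s ha ih =>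
    simp only [Finset.sum_insert ha]
    rw [J_add, ih]

/-- Set of path elements. -/
def Is (l : List (T × T)) : Finset T := (l.map Prod.fst).toFinset
/-- Set of sampled copies. -/
def Rs (l : List (T × T)) : Finset T := (l.map Prod.snd).toFinset

lemma contract_empty (f : Finset T → ℝ) (S : Finset T) : contract f S ∅ = 0 := by
  simp [contract]

lemma adap_eq (τ : DTree T) (h : τ.valid) (f : Finset T → ℝ) (hf : f ∅ = 0) :
    adap τ f = J τ (fun l => f (Is l)) := by
  induction τ generalizing f with
  | leaf => simp [adap, J, Is, hf]
  | node μ c ih =>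
    obtain ⟨h0, h1, h2⟩ := h
    simp only [J, adap]
    have e : ∀ (i r : T) (l : List (T × T)), Is ((i, r) :: l) = {i} ∪ Is l := by
      intro i r l; ext; simp [Is]
    simp only [e]
    rw [dsum μ h1 (fun i => J (c i) fun l => f ({i} ∪ Is l))]
    refine Finset.sum_congr rfl fun i _ => ?_
    rw [ih i (h2 i) _ (contract_empty _ _)]
    simp only [contract]
    rw [J_sub_const (c i) (h2 i)]
    ring

lemma alg_eq (τ : DTree T) (h : τ.valid) (f : Finset T → ℝ) (hf : f ∅ = 0) :
    alg τ f = J τ (fun l => f (Rs l)) := by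
  induction τ generalizing f with
  | leaf => simp [alg, J, Rs, hf]
  | node μ c ih =>
    obtain ⟨h0, h1, h2⟩ := h
    simp only [J, alg]
    have e : ∀ (i r : T) (l : List (T × T)), Rs ((i, r) :: l) = {r} ∪ Rs l := by
      intro i r l; ext; simp [Rs]
    simp only [e]
    refine Finset.sum_congr rfl fun i _ => Finset.sum_congr rfl fun r _ => ?_
    rw [ih i (h2 i) _ (contract_empty _ _)]
    simp only [contract]
    rw [J_sub_const (c i) (h2 i)]
    ring

/-- `t` is a new element that can be added to `G`. -/
def ad (F : Finset (Finset T)) (G : Finset T) (t : T) : Prop := t ∉ G ∧ insert t G ∈ F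

instance (F : Finset (Finset T)) (G : Finset T) (t : T) : Decidable (ad F G t) := by
  unfold ad; infer_instance

/-- One greedy step. -/
def stp (F : Finset (Finset T)) (G : Finset T) (t : T) : Finset T :=
  if ad F G t then insert t G else G

/-- Greedy set built along the copies. -/
def gr (F : Finset (Finset T)) : Finset T → List (T × T) → Finset T
  | G, [] => G
  | G, p :: l => gr F (stp F G p.2) l

/-- Number of path elements which were addable when they came. -/
def cnt (F : Finset (Finset T)) : Finset T → List (T × T) → ℝ
  | _, [] => 0
  | G, p :: l => (if ad F G p.1 then 1 else 0) + cnt F (stp F G p.2) l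

lemma card_stp (F : Finset (Finset T)) (G : Finset T) (t : T) :
    ((stp F G t).card : ℝ) = G.card + (if ad F G t then 1 else 0) := by
  unfold stp
  split_ifs with h
  · rw [Finset.card_insert_of_notMem h.1]; push_cast; ring
  · simp

lemma J_greedy (F : Finset (Finset T)) (τ : DTree T) (h : τ.valid) (G : Finset T) :
    J τ (fun l => cnt F G l - (gr F G l).card) = - (G.card : ℝ) := by
  induction τ generalizing G with
  | leaf => simp [J, cnt, gr]
  | node μ c ih =>
    obtain ⟨h0, h1, h2⟩ := h
    simp only [J, cnt, gr]
    have key : ∀ i r, J (c i) (fun l => (if ad F G i then (1:ℝ) else 0) + cnt F (stp F G r) l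
        - ((gr F (stp F G r) l).card : ℝ)) =
        (if ad F G i then (1:ℝ) else 0) - (if ad F G r then (1:ℝ) else 0) - G.card := by
      intro i r
      have := J_add (c i) (fun _ => (if ad F G i then (1:ℝ) else 0))
        (fun l => cnt F (stp F G r) l - ((gr F (stp F G r) l).card : ℝ))
      rw [J_const _ (h2 i), ih i (h2 i), card_stp] at this
      simp only [add_sub_assoc]
      rw [this]; ring
    simp only [key, mul_sub, Finset.sum_sub_distrib]
    rw [dsum μ h1 (fun i => if ad F G i then (1:ℝ) else 0),
      dsum' μ h1 (fun i => if ad F G i then (1:ℝ) else 0),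
      dsum μ h1 (fun _ => (G.card : ℝ)), ← Finset.sum_mul, h1]
    ring

lemma sub_stp (F : Finset (Finset T)) (G : Finset T) (t : T) : G ⊆ stp F G t := by
  unfold stp; split_ifs
  · exact Finset.subset_insert _ _
  · exact subset_rfl

lemma sub_gr (F : Finset (Finset T)) (l : List (T × T)) (G : Finset T) : G ⊆ gr F G l := by
  induction l generalizing G with
  | nil => exact subset_rfl
  | cons p l ih => exact (sub_stp F G p.2).trans (ih _)

lemma gr_mem (F : Finset (Finset T)) (l : List (T × T)) (G : Finset T) (hG : G ∈ F) :
    gr F G l ∈ F := by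
  induction l generalizing G with
  | nil => exact hG
  | cons p l ih =>
    apply ih
    unfold stp; split_ifs with h
    · exact h.2
    · exact hG

lemma gr_sub (F : Finset (Finset T)) (l : List (T × T)) (G : Finset T) :
    gr F G l ⊆ G ∪ Rs l := by
  induction l generalizing G with
  | nil => simp [gr]
  | cons p l ih =>
    refine (ih _).trans ?_
    intro x hx
    unfold stp at hx
    split_ifs at hx <;> simp [Rs] at hx ⊢ <;> tauto

lemma cnt_bound (F : Finset (Finset T)) (hdc : DownwardClosed F) (l : List (T × T))
    (G : Finset T) :
    (((Is l).filter (fun t => ad F (gr F G l) t)).card : ℝ) ≤ cnt F G l := by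
  induction l generalizing G with
  | nil => simp [Is, cnt]
  | cons p l ih =>
    have e : Is (p :: l) = insert p.1 (Is l) := by ext; simp [Is]
    have := ih (stp F G p.2)
    simp only [gr, cnt, e]
    rw [Finset.filter_insert]
    split_ifs with h1 h2 h2
    · have h3 := Finset.card_insert_le p.1
        ((Is l).filter (fun t => ad F (gr F (stp F G p.2) l) t))
      have h4 : ((insert p.1 ((Is l).filter
        (fun t => ad F (gr F (stp F G p.2) l) t))).card : ℝ) ≤
        ((Is l).filter (fun t => ad F (gr F (stp F G p.2) l) t)).card + 1 := by
        exact_mod_cast h3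
      linarith
    · exfalso
      apply h2
      have hs : G ⊆ gr F (stp F G p.2) l := (sub_stp F G p.2).trans (sub_gr F l _)
      exact ⟨fun h => h1.1 (hs h), hdc.2 _ h1.2 _ (Finset.insert_subset_insert _ hs)⟩
    · linarith
    · linarith

lemma ext_lemma (k : ℕ) (F : Finset (Finset T)) (hdc : DownwardClosed F)
    (hext : KExtendible k F) (B : Finset T) (hB : B ∈ F) (A : Finset T) (hA : A ∈ F) :
    ∃ B' ⊆ B, A ∪ B' ∈ F ∧ B.card ≤ B'.card + k * A.card := by
  induction A using Finset.induction_on with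
  | empty => exact ⟨B, subset_rfl, by simpa using hB, by simp⟩
  | insert e A he ih =>
    obtain ⟨B', hB', hF, hc⟩ := ih (hdc.2 _ hA _ (Finset.subset_insert _ _))
    obtain ⟨Z, hZ, hZc, hZF⟩ := hext A (A ∪ B') Finset.subset_union_left hF e
      (by rw [Finset.union_comm, ← Finset.insert_eq]; exact hA)
    refine ⟨B' \ Z, Finset.sdiff_subset.trans hB', hdc.2 _ hZF _ ?_, ?_⟩
    · intro x hx
      have hx2 : x ∈ Z → x ∉ A := fun h => (Finset.mem_sdiff.1 (hZ h)).2
      simp at hx ⊢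
      tauto
    · have h1 : B'.card ≤ (B' \ Z).card + Z.card := by
        have := Finset.card_le_card_sdiff_add_card (s := B') (t := Z)
        omega
      rw [Finset.card_insert_of_notMem he]
      nlinarith

lemma class_bound (k : ℕ) (F : Finset (Finset T)) (hdc : DownwardClosed F)
    (hext : KExtendible k F) (l : List (T × T)) (B : Finset T) (hB : B ∈ F) (hBI : B ⊆ Is l) :
    (B.card : ℝ) ≤ (k + 1) * (gr F ∅ l).card + cnt F ∅ l := by
  obtain ⟨B', hB', hF, hc⟩ := ext_lemma k F hdc hext B hB (gr F ∅ l) (gr_mem F l ∅ hdc.1)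
  have h1 : B' ⊆ gr F ∅ l ∪ (Is l).filter (fun t => ad F (gr F ∅ l) t) := by
    intro x hx
    by_cases hg : x ∈ gr F ∅ l
    · exact Finset.mem_union_left _ hg
    · refine Finset.mem_union_right _ (Finset.mem_filter.2 ⟨hBI (hB' hx), hg, ?_⟩)
      refine hdc.2 _ hF _ (Finset.insert_subset (Finset.mem_union_right _ hx)
        Finset.subset_union_left)
  have h2 := (Finset.card_le_card h1).trans (Finset.card_union_le _ _)
  have h3 := cnt_bound F hdc l ∅
  have h4 : (B'.card : ℝ) ≤ (gr F ∅ l).card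
      + ((Is l).filter (fun t => ad F (gr F ∅ l) t)).card := by exact_mod_cast h2
  have h5 : (B.card : ℝ) ≤ B'.card + k * (gr F ∅ l).card := by exact_mod_cast hc
  linarith

lemma geom (k h : ℕ) (hkh : k + 1 ≤ 2 ^ h) (S : Finset ℤ) (c : ℤ)
    (hm : ∀ j ∈ S, j < c ∧ (h : ℤ) ∣ c - j) :
    (k : ℝ) * ∑ j ∈ S, (2 : ℝ) ^ j ≤ 2 ^ c := by
  induction S using Finset.induction_on_max generalizing c with
  | empty => simp; positivity
  | insert a s ha ih =>
    have hna : a ∉ s := fun h => lt_irrefl _ (ha a h)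
    rw [Finset.sum_insert hna]
    obtain ⟨h1, h2⟩ := hm a (Finset.mem_insert_self _ _)
    have h3 := ih a (fun j hj => ⟨ha j hj, by
      have := (hm j (Finset.mem_insert_of_mem hj)).2
      have h4 := dvd_sub this h2
      simpa using h4⟩)
    have h5 : (h : ℤ) ≤ c - a := Int.le_of_dvd (by omega) h2
    have h6 : (2 : ℝ) ^ ((h : ℤ) + a) ≤ 2 ^ c :=
      zpow_le_zpow_right₀ (by norm_num) (by omega)
    rw [zpow_add₀ (by norm_num), zpow_natCast] at h6
    have h7 : (k : ℝ) + 1 ≤ 2 ^ h := by exact_mod_cast hkh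
    have h8 : (0 : ℝ) < 2 ^ a := by positivity
    nlinarith

lemma combine (k : ℕ) (F : Finset (Finset T)) (hdc : DownwardClosed F)
    (hext : KExtendible k F) (cl : T → ℤ) (G : ℤ → Finset T) (hG : ∀ j, G j ∈ F)
    (hcl : ∀ j, ∀ t ∈ G j, cl t = j) (S : Finset ℤ) :
    ∃ H ∈ F, H ⊆ S.biUnion G ∧ ∑ j ∈ S, (2 : ℝ) ^ j * (G j).card ≤
      ∑ t ∈ H, ((2 : ℝ) ^ (cl t) + k * ∑ j ∈ S.filter (· < cl t), (2 : ℝ) ^ j) := by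
  induction S using Finset.induction_on_min with
  | empty => exact ⟨∅, hdc.1, by simp, by simp⟩
  | insert a s ha ih =>
    obtain ⟨H, hH, hHs, hs⟩ := ih
    have hna : a ∉ s := fun h => lt_irrefl _ (ha a h)
    obtain ⟨B, hB, hF, hc⟩ := ext_lemma k F hdc hext (G a) (hG a) H hH
    have hHcl : ∀ t ∈ H, a < cl t := by
      intro t ht
      obtain ⟨j, hj, hj2⟩ := Finset.mem_biUnion.1 (hHs ht)
      rw [hcl j t hj2]; exact ha j hj
    have hdis : Disjoint H B := by
      rw [Finset.disjoint_left]
      intro t ht ht2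
      have := hHcl t ht
      rw [hcl a t (hB ht2)] at this
      exact lt_irrefl _ this
    refine ⟨H ∪ B, hF, ?_, ?_⟩
    · rw [Finset.biUnion_insert]
      exact Finset.union_subset (hHs.trans Finset.subset_union_right)
        (hB.trans Finset.subset_union_left)
    · rw [Finset.sum_insert hna, Finset.sum_union hdis]
      have e1 : ∑ t ∈ H, ((2 : ℝ) ^ (cl t)
          + k * ∑ j ∈ (insert a s).filter (· < cl t), (2 : ℝ) ^ j) =
          ∑ t ∈ H, ((2 : ℝ) ^ (cl t) + k * ∑ j ∈ s.filter (· < cl t), (2 : ℝ) ^ j)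
          + H.card * (k * 2 ^ a) := by
        rw [← nsmul_eq_mul, ← Finset.sum_const, ← Finset.sum_add_distrib]
        refine Finset.sum_congr rfl fun t ht => ?_
        rw [Finset.filter_insert, if_pos (hHcl t ht), Finset.sum_insert (by simp [hna])]
        ring
      have e2 : (B.card : ℝ) * 2 ^ a ≤ ∑ t ∈ B, ((2 : ℝ) ^ (cl t)
          + k * ∑ j ∈ (insert a s).filter (· < cl t), (2 : ℝ) ^ j) := by
        rw [← nsmul_eq_mul, ← Finset.sum_const]
        refine Finset.sum_le_sum fun t ht => ?_
        rw [hcl a t (hB ht)]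
        have : (0 : ℝ) ≤ k * ∑ j ∈ (insert a s).filter (· < a), (2 : ℝ) ^ j := by positivity
        linarith
      have hc' : ((G a).card : ℝ) ≤ B.card + k * H.card := by exact_mod_cast hc
      have h8 : (0 : ℝ) < 2 ^ a := by positivity
      have := mul_le_mul_of_nonneg_left hc' h8.le
      rw [e1]
      nlinarith

lemma wrank_ge (F : Finset (Finset T)) (w : T → ℝ) (A B : Finset T)
    (hB : B ∈ F) (hBA : B ⊆ A) : ∑ t ∈ B, w t ≤ wrank F w A := by
  have hne : F.Nonempty := ⟨B, hB⟩
  rw [wrank, dif_pos hne]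
  have := Finset.le_sup' (fun B => ∑ t ∈ A ∩ B, w t) hB
  rwa [Finset.inter_eq_right.2 hBA] at this

lemma wrank_ex (F : Finset (Finset T)) (hdc : DownwardClosed F) (w : T → ℝ) (A : Finset T) :
    ∃ B ∈ F, B ⊆ A ∧ wrank F w A = ∑ t ∈ B, w t := by
  have hne : F.Nonempty := ⟨∅, hdc.1⟩
  rw [wrank, dif_pos hne]
  obtain ⟨B, hB, h⟩ := Finset.exists_mem_eq_sup' hne (fun B => ∑ t ∈ A ∩ B, w t)
  exact ⟨A ∩ B, hdc.2 B hB _ Finset.inter_subset_right, Finset.inter_subset_left, h⟩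

/-- Subfamily of the sets all of whose elements are in class `j`. -/
def Fc (F : Finset (Finset T)) (cl : T → ℤ) (j : ℤ) : Finset (Finset T) :=
  F.filter (fun B => ∀ t ∈ B, cl t = j)

lemma Fc_dc (F : Finset (Finset T)) (hdc : DownwardClosed F) (cl : T → ℤ) (j : ℤ) :
    DownwardClosed (Fc F cl j) := by
  refine ⟨by simp [Fc, hdc.1], fun B hB A hA => ?_⟩
  rw [Fc, Finset.mem_filter] at hB ⊢
  exact ⟨hdc.2 B hB.1 A hA, fun t ht => hB.2 t (hA ht)⟩

lemma Fc_ext (k : ℕ) (F : Finset (Finset T)) (hext : KExtendible k F) (cl : T → ℤ) (j : ℤ) :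
    KExtendible k (Fc F cl j) := by
  intro A B hAB hB e he
  rw [Fc, Finset.mem_filter] at hB he
  obtain ⟨Z, hZ, hZc, hZF⟩ := hext A B hAB hB.1 e he.1
  refine ⟨Z, hZ, hZc, ?_⟩
  rw [Fc, Finset.mem_filter]
  refine ⟨hZF, fun t ht => ?_⟩
  rcases Finset.mem_union.1 ht with h | h
  · exact hB.2 t (Finset.mem_sdiff.1 h).1
  · exact he.2 t (Finset.mem_union_right _ h)

lemma residue_bound (k h : ℕ) (hkh : k + 1 ≤ 2 ^ h) (F : Finset (Finset T))
    (hdc : DownwardClosed F) (hext : KExtendible k F) (w : T → ℝ) (cl : T → ℤ)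
    (hcl : ∀ t, (2 : ℝ) ^ (cl t - 1) ≤ w t)
    (l : List (T × T)) (S : Finset ℤ) (r : ℤ) (hS : ∀ j ∈ S, j % h = r) :
    ∑ j ∈ S, (2 : ℝ) ^ j * (gr (Fc F cl j) ∅ l).card ≤ 4 * wrank F w (Rs l) := by
  have hmem : ∀ j, gr (Fc F cl j) ∅ l ∈ Fc F cl j := fun j =>
    gr_mem _ l ∅ (Fc_dc F hdc cl j).1
  have hm2 : ∀ j, ∀ t ∈ gr (Fc F cl j) ∅ l, cl t = j := fun j =>
    (Finset.mem_filter.1 (hmem j)).2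
  obtain ⟨H, hH, hHs, hle⟩ := combine k F hdc hext cl (fun j => gr (Fc F cl j) ∅ l)
    (fun j => (Finset.mem_filter.1 (hmem j)).1) hm2 S
  refine hle.trans ?_
  have hHR : H ⊆ Rs l := by
    intro t ht
    obtain ⟨j, hj, hj2⟩ := Finset.mem_biUnion.1 (hHs ht)
    simpa using gr_sub _ l ∅ hj2
  refine le_trans ?_ (mul_le_mul_of_nonneg_left (wrank_ge F w (Rs l) H hH hHR) (by norm_num))
  rw [Finset.mul_sum]
  refine Finset.sum_le_sum fun t ht => ?_
  obtain ⟨j0, hj0, hj2⟩ := Finset.mem_biUnion.1 (hHs ht)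
  have hc0 : cl t = j0 := hm2 j0 t hj2
  have h1 := geom k h hkh (S.filter (· < cl t)) (cl t) (by
    intro j hj
    rw [Finset.mem_filter] at hj
    refine ⟨hj.2, ?_⟩
    have h3 : j % h = cl t % h := by rw [hS j hj.1, hc0, hS j0 hj0]
    exact Int.ModEq.dvd h3)
  have h2 := hcl t
  rw [zpow_sub_one₀ (by norm_num)] at h2
  linarith

lemma all_bound (k h : ℕ) (hh : 0 < h) (hkh : k + 1 ≤ 2 ^ h) (F : Finset (Finset T))
    (hdc : DownwardClosed F) (hext : KExtendible k F) (w : T → ℝ) (cl : T → ℤ)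
    (hcl : ∀ t, (2 : ℝ) ^ (cl t - 1) ≤ w t)
    (l : List (T × T)) (S : Finset ℤ) :
    ∑ j ∈ S, (2 : ℝ) ^ j * (gr (Fc F cl j) ∅ l).card ≤ h * (4 * wrank F w (Rs l)) := by
  have hh' : (0 : ℤ) < h := by exact_mod_cast hh
  rw [← Finset.sum_fiberwise_of_maps_to (t := Finset.Ico (0 : ℤ) h) (g := fun j => j % (h : ℤ))
    (fun j _ => Finset.mem_Ico.2 ⟨Int.emod_nonneg _ hh'.ne', Int.emod_lt_of_pos _ hh'⟩)]
  refine (Finset.sum_le_card_nsmul _ _ (4 * wrank F w (Rs l)) fun r _ => ?_).trans ?_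
  · exact residue_bound k h hkh F hdc hext w cl hcl l _ r
      (fun j hj => (Finset.mem_filter.1 hj).2)
  · simp

lemma path_bound (k : ℕ) (F : Finset (Finset T))
    (hdc : DownwardClosed F) (hext : KExtendible k F) (w : T → ℝ) (cl : T → ℤ)
    (hcl : ∀ t, w t ≤ (2 : ℝ) ^ (cl t)) (l : List (T × T)) :
    wrank F w (Is l) ≤ ∑ j ∈ Finset.univ.image cl, (2 : ℝ) ^ j *
      ((k + 1) * (gr (Fc F cl j) ∅ l).card + cnt (Fc F cl j) ∅ l) := by
  obtain ⟨B, hB, hBI, he⟩ := wrank_ex F hdc w (Is l)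
  rw [he, ← Finset.sum_fiberwise_of_maps_to (t := Finset.univ.image cl) (g := cl)
    (fun t _ => Finset.mem_image_of_mem _ (Finset.mem_univ _))]
  refine Finset.sum_le_sum fun j _ => ?_
  have h1 : B.filter (fun t => cl t = j) ∈ Fc F cl j := by
    rw [Fc, Finset.mem_filter]
    exact ⟨hdc.2 B hB _ (Finset.filter_subset _ _), fun t ht => (Finset.mem_filter.1 ht).2⟩
  have h2 := class_bound k _ (Fc_dc F hdc cl j) (Fc_ext k F hext cl j) l _ h1
    ((Finset.filter_subset _ _).trans hBI)
  refine (Finset.sum_le_card_nsmul _ _ ((2 : ℝ) ^ j) fun t ht => ?_).trans ?_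
  · rw [← (Finset.mem_filter.1 ht).2]; exact hcl t
  · rw [nsmul_eq_mul, mul_comm]
    exact mul_le_mul_of_nonneg_left h2 (by positivity)

end AdapGap

/-- Theorem 4.3: for the weighted rank function of a downward-closed
`k`-extendible system (`k ≥ 2`), `adap(𝒯, f) ≤ 32 · k · log₂ k · alg(𝒯, f)`. -/
theorem kExtendible_weighted_adaptivity_gap_le
    {T : Type*} [Fintype T] [DecidableEq T]
    (k : ℕ) (hk : 2 ≤ k) (F : Finset (Finset T))
    (hdc : DownwardClosed F) (hext : KExtendible k F)
    (w : T → ℝ) (hw : ∀ t, 0 < w t)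
    (𝒯 : DTree T) (h𝒯 : 𝒯.valid) :
    adap 𝒯 (wrank F w) ≤ 32 * (k : ℝ) * Real.logb 2 k * alg 𝒯 (wrank F w) := by
  have h0 : wrank F w ∅ = 0 := by
    obtain ⟨B, _, hB, h⟩ := AdapGap.wrank_ex F hdc w ∅
    rw [h, Finset.subset_empty.1 hB, Finset.sum_empty]
  rw [AdapGap.adap_eq _ h𝒯 _ h0, AdapGap.alg_eq _ h𝒯 _ h0]
  set h := Nat.log 2 k + 1 with hh
  have hkh : k + 1 ≤ 2 ^ h := Nat.lt_pow_succ_log_self (by norm_num) k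
  let cl : T → ℤ := fun t => Int.clog 2 (w t)
  have hcl1 : ∀ t, (2 : ℝ) ^ (cl t - 1) ≤ w t := fun t => by
    have := Int.zpow_pred_clog_lt_self (b := 2) (by norm_num) (hw t)
    exact_mod_cast this.le
  have hcl2 : ∀ t, w t ≤ (2 : ℝ) ^ (cl t) := fun t => by
    have := Int.self_le_zpow_clog (b := 2) (by norm_num) (w t)
    exact_mod_cast this
  have hpt : ∀ l, wrank F w (AdapGap.Is l) ≤
      ((k + 2) * (h * 4) : ℝ) * wrank F w (AdapGap.Rs l) +
      ∑ j ∈ Finset.univ.image cl, (2 : ℝ) ^ j * (AdapGap.cnt (AdapGap.Fc F cl j) ∅ l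
        - (AdapGap.gr (AdapGap.Fc F cl j) ∅ l).card) := by
    intro l
    have h1 := AdapGap.path_bound k F hdc hext w cl hcl2 l
    have h2 := AdapGap.all_bound k h (by omega) hkh F hdc hext w cl hcl1 l
      (Finset.univ.image cl)
    have h3 := mul_le_mul_of_nonneg_left h2 (show (0 : ℝ) ≤ (k : ℝ) + 2 by positivity)
    rw [Finset.mul_sum] at h3
    have h4 : ∑ j ∈ Finset.univ.image cl, (2 : ℝ) ^ j *
        ((k + 1) * (AdapGap.gr (AdapGap.Fc F cl j) ∅ l).card
          + AdapGap.cnt (AdapGap.Fc F cl j) ∅ l) =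
        ∑ j ∈ Finset.univ.image cl, ((k : ℝ) + 2) *
          ((2 : ℝ) ^ j * (AdapGap.gr (AdapGap.Fc F cl j) ∅ l).card) +
        ∑ j ∈ Finset.univ.image cl, (2 : ℝ) ^ j * (AdapGap.cnt (AdapGap.Fc F cl j) ∅ l
        - (AdapGap.gr (AdapGap.Fc F cl j) ∅ l).card) := by
      rw [← Finset.sum_add_distrib]
      refine Finset.sum_congr rfl fun j _ => ?_
      ring
    rw [h4] at h1
    linarith
  have hJ := AdapGap.J_mono 𝒯 h𝒯 _ _ hpt
  rw [AdapGap.J_add, AdapGap.J_mul, AdapGap.J_sum _ _ h𝒯] at hJ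
  simp only [AdapGap.J_mul, AdapGap.J_greedy _ _ h𝒯] at hJ
  simp only [Finset.card_empty, Nat.cast_zero, neg_zero, mul_zero, Finset.sum_const_zero,
    add_zero] at hJ
  refine hJ.trans ?_
  have hnn : 0 ≤ AdapGap.J 𝒯 (fun l => wrank F w (AdapGap.Rs l)) := by
    rw [← AdapGap.J_const 𝒯 h𝒯 0]
    refine AdapGap.J_mono 𝒯 h𝒯 _ _ fun l => ?_
    simpa using AdapGap.wrank_ge F w (AdapGap.Rs l) ∅ hdc.1 (Finset.empty_subset _)
  refine mul_le_mul_of_nonneg_right ?_ hnn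
  have hk' : (2 : ℝ) ≤ k := by exact_mod_cast hk
  have hl1 : (1 : ℝ) ≤ Real.logb 2 k := by
    rw [Real.le_logb_iff_rpow_le (by norm_num) (by linarith)]
    simpa using hk'
  have hl2 : (Nat.log 2 k : ℝ) ≤ Real.logb 2 k := by
    exact_mod_cast Real.natLog_le_logb k 2
  have hl3 : (h : ℝ) ≤ 2 * Real.logb 2 k := by
    rw [hh]; push_cast; linarith
  have h5 : ((k : ℝ) + 2) * (h * 4) ≤ (2 * k) * ((2 * Real.logb 2 k) * 4) := by
    gcongr; linarith
  have h6 : 0 ≤ (k : ℝ) * Real.logb 2 k := by positivity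
  nlinarith
end

section
/- Let T be a finite type, let k ≥ 2 be a natural number, let F be a downward-closed k-extendible system of finsets of T, let w : T → ℝ be strictly positive weights, and let f be the weighted rank function of F with weights w. For each integer j let f_j be the unweighted class rank function f_j(A) := max_{B ∈ F} |{t ∈ A ∩ B : 2^{j−1} < w(t) ≤ 2^j}|. Then for every decision tree 𝒯 over T, alg(𝒯, f) ≥ (1 / (16 · log₂ k)) · Σ_j 2^j · alg(𝒯, f_j), where the sum ranges over the finitely many integers j for which some t ∈ T satisfies 2^{j−1} < w(t) ≤ 2^j. (Lemma 4.4.) -/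
open Finset

/-- Merging: `S` together with all but `k |S|` elements of `B` is independent. -/
lemma merge_aux {T : Type*} [DecidableEq T] (k : ℕ) (F : Finset (Finset T))
    (hdc : DownwardClosed F) (hext : KExtendible k F) (B : Finset T) (hB : B ∈ F)
    (S : Finset T) : S ∈ F → ∃ Z : Finset T, Z.card ≤ k * S.card ∧ S ∪ (B \ Z) ∈ F := by
  induction S using Finset.induction_on with
  | empty => intro _; exact ⟨∅, by simp, by simpa using hB⟩
  | insert e S he ih =>
    intro hS
    obtain ⟨Z, hZ, hZF⟩ := ih (hdc.2 _ hS _ (Finset.subset_insert _ _))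
    obtain ⟨Y, hY, hYc, hYF⟩ := hext S (S ∪ (B \ Z)) Finset.subset_union_left hZF e
      (by rwa [Finset.union_comm, ← Finset.insert_eq])
    refine ⟨Z ∪ Y, ?_, hdc.2 _ hYF _ ?_⟩
    · rw [Finset.card_insert_of_notMem he]
      have := Finset.card_union_le Z Y
      nlinarith
    · intro x hx
      have hx2 : x ∈ Y → x ∉ S := fun h => (Finset.mem_sdiff.mp (hY h)).2
      simp only [Finset.mem_union, Finset.mem_insert, Finset.mem_sdiff,
        Finset.mem_singleton] at hx ⊢
      tauto

/-- Greedy over well separated classes. -/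
lemma greedy_aux {T : Type*} [DecidableEq T] (k L : ℕ) (hL : 1 ≤ L) (hkL : k + 1 ≤ 2 ^ L)
    (F : Finset (Finset T)) (hdc : DownwardClosed F) (hext : KExtendible k F)
    (w : T → ℝ) (A : Finset T) (K : Finset ℤ) :
    (∀ a ∈ K, ∀ b ∈ K, a < b → a + L ≤ b) →
    ∃ S ∈ F, S ⊆ A ∧ (∀ t ∈ S, ∃ j ∈ K, (2:ℝ)^(j-1) < w t) ∧
      ∀ m : ℤ, (∀ j ∈ K, m + L ≤ j) →
        ∑ j ∈ K, (2:ℝ)^j * classRank F w j A + S.card * (2:ℝ)^(m + L) ≤ 4 * ∑ t ∈ S, w t := by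
  classical
  induction K using Finset.induction_on_min with
  | empty => intro _; exact ⟨∅, hdc.1, by simp, by simp, by simp⟩
  | insert m K hm ih =>
    intro hsep
    obtain ⟨S, hSF, hSA, hSw, hS⟩ := ih (fun a ha b hb => hsep a (by simp [ha]) b (by simp [hb]))
    have hmK : ∀ j ∈ K, m + L ≤ j := fun j hj => hsep m (by simp) j (by simp [hj]) (hm j hj)
    obtain ⟨B, hB, hBeq⟩ := Finset.exists_mem_eq_sup F ⟨∅, hdc.1⟩ (fun B =>
      ((A ∩ B).filter fun t => (2:ℝ)^(m-1) < w t ∧ w t ≤ (2:ℝ)^m).card)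
    set C := (A ∩ B).filter fun t => (2:ℝ)^(m-1) < w t ∧ w t ≤ (2:ℝ)^m with hC
    have hrank : classRank F w m A = C.card := by
      unfold classRank
      rw [Nat.cast_inj]
      convert hBeq
    have hCB : C ⊆ B := (Finset.filter_subset _ _).trans Finset.inter_subset_right
    have hCA : C ⊆ A := (Finset.filter_subset _ _).trans Finset.inter_subset_left
    obtain ⟨Z, hZ, hZF⟩ := merge_aux k F hdc hext C (hdc.2 _ hB _ hCB) S hSF
    have hdisj : Disjoint S (C \ Z) := by
      rw [Finset.disjoint_left]
      intro t ht htC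
      obtain ⟨j, hj, hjw⟩ := hSw t ht
      have h1 := (Finset.mem_filter.mp (Finset.mem_sdiff.mp htC).1).2.2
      have h2 : (2:ℝ)^m ≤ (2:ℝ)^(j-1) :=
        zpow_le_zpow_right₀ (by norm_num) (by have := hm j hj; omega)
      linarith
    have hmnot : m ∉ K := fun h => lt_irrefl _ (hm m h)
    refine ⟨S ∪ (C \ Z), hZF, Finset.union_subset hSA (Finset.sdiff_subset.trans hCA), ?_, ?_⟩
    · intro t ht
      rcases Finset.mem_union.mp ht with h | h
      · obtain ⟨j, hj, hjw⟩ := hSw t h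
        exact ⟨j, by simp [hj], hjw⟩
      · exact ⟨m, by simp, (Finset.mem_filter.mp (Finset.mem_sdiff.mp h).1).2.1⟩
    · intro m' hm'
      have h1 := hS m hmK
      have h2 : (2:ℝ)^(m' + L) ≤ (2:ℝ)^m :=
        zpow_le_zpow_right₀ (by norm_num) (hm' m (by simp))
      rw [Finset.sum_insert hmnot, Finset.card_union_of_disjoint hdisj,
        Finset.sum_union hdisj, hrank]
      have h3 : (C.card : ℝ) ≤ (C \ Z).card + k * S.card := by
        have := Finset.card_le_card_sdiff_add_card (s := C) (t := Z)
        exact_mod_cast (by omega : C.card ≤ (C \ Z).card + k * S.card)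
      have h4 : ((C \ Z).card : ℝ) * (2:ℝ)^(m-1) ≤ ∑ t ∈ C \ Z, w t := by
        rw [← nsmul_eq_mul]
        exact Finset.card_nsmul_le_sum _ _ _ (fun t ht =>
          (Finset.mem_filter.mp (Finset.mem_sdiff.mp ht).1).2.1.le)
      have h5 : (2:ℝ)^m = 2 * (2:ℝ)^(m-1) := by
        rw [zpow_sub_one₀ (by norm_num)]; ring
      have h6 : (2:ℝ)^(m + (L:ℤ)) = (2:ℝ)^m * 2^L := by
        rw [zpow_add₀ (by norm_num), zpow_natCast]
      have h7 : (k:ℝ) + 1 ≤ 2^L := by exact_mod_cast hkL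
      have hp : (0:ℝ) < (2:ℝ)^m := by positivity
      set p := (2:ℝ)^m
      push_cast
      have e1 : p * C.card ≤ p * ((C \ Z).card + k * S.card) := by gcongr
      have e2 : ((S.card : ℝ) + (C \ Z).card) * (2:ℝ)^(m' + (L:ℤ))
          ≤ ((S.card : ℝ) + (C \ Z).card) * p := by gcongr
      have e3 : (S.card : ℝ) * p * ((k:ℝ) + 1) ≤ (S.card : ℝ) * p * 2^L := by gcongr
      rw [h6] at h1
      have e4 : 2 * (((C \ Z).card : ℝ) * p) ≤ 4 * ∑ t ∈ C \ Z, w t := by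
        rw [h5]; linarith
      linarith

/-- Pointwise comparison of rank functions. -/
lemma pointwise_aux {T : Type*} [DecidableEq T] (k : ℕ) (hk : 2 ≤ k)
    (F : Finset (Finset T)) (hdc : DownwardClosed F) (hext : KExtendible k F)
    (w : T → ℝ) (J : Finset ℤ) (A : Finset T) :
    (1 / (16 * Real.logb 2 k)) * ∑ j ∈ J, (2:ℝ)^j * classRank F w j A ≤ wrank F w A := by
  set L := Nat.log 2 k + 1 with hLdef
  have hL : 1 ≤ L := by omega
  have hkL : k + 1 ≤ 2 ^ L := Nat.lt_pow_succ_log_self (by norm_num) k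
  have hF : F.Nonempty := ⟨∅, hdc.1⟩
  have hS : ∀ S ∈ F, S ⊆ A → ∑ t ∈ S, w t ≤ wrank F w A := by
    intro S hS hSA
    unfold wrank
    rw [dif_pos hF]
    have := Finset.le_sup' (fun B => ∑ t ∈ A ∩ B, w t) hS
    rwa [Finset.inter_eq_right.mpr hSA] at this
  have h0 : 0 ≤ wrank F w A := by simpa using hS ∅ hdc.1 (by simp)
  have key : ∀ r : ℤ, ∑ j ∈ J with j % (L:ℤ) = r, (2:ℝ)^j * classRank F w j A
      ≤ 4 * wrank F w A := by
    intro r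
    obtain ⟨S, hSF, hSA, -, h⟩ := greedy_aux k L hL hkL F hdc hext w A
      (J.filter fun j => j % (L:ℤ) = r) (by
        intro a ha b hb hab
        simp only [Finset.mem_filter] at ha hb
        have hd : (L:ℤ) ∣ b - a := Int.ModEq.dvd (ha.2.trans hb.2.symm)
        have := Int.le_of_dvd (by omega) hd
        omega)
    obtain ⟨m, hm⟩ : ∃ m : ℤ, ∀ j ∈ J.filter (fun j => j % (L:ℤ) = r), m ≤ j := by
      obtain ⟨m, hm⟩ := (J.filter (fun j => j % (L:ℤ) = r)).bddBelow
      exact ⟨m, fun j hj => hm (by simpa using hj)⟩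
    have h1 := h (m - L) (fun j hj => by have := hm j hj; omega)
    have h2 := hS S hSF hSA
    have h3 : 0 ≤ (S.card : ℝ) * (2:ℝ)^(m - L + L) := by positivity
    linarith
  have htot : ∑ j ∈ J, (2:ℝ)^j * classRank F w j A ≤ L * (4 * wrank F w A) := by
    rw [← Finset.sum_fiberwise_of_maps_to (s := J) (t := Finset.Ico (0:ℤ) L)
      (g := fun j => j % (L:ℤ)) (fun j _ => by
        simp only [Finset.mem_Ico]
        exact ⟨Int.emod_nonneg _ (by omega), Int.emod_lt_of_pos _ (by omega)⟩)]
    calc _ ≤ ∑ r ∈ Finset.Ico (0:ℤ) L, 4 * wrank F w A := Finset.sum_le_sum (fun r _ => key r)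
      _ = _ := by simp
  have hlog1 : 1 ≤ Real.logb 2 k := by
    rw [Real.le_logb_iff_rpow_le (by norm_num) (by positivity)]
    simpa using (by exact_mod_cast hk : (2:ℝ) ≤ k)
  have hlog2 : (Nat.log 2 k : ℝ) ≤ Real.logb 2 k := by
    exact_mod_cast Real.natLog_le_logb k 2
  have hLr : (L:ℝ) ≤ 2 * Real.logb 2 k := by rw [hLdef]; push_cast; linarith
  rw [one_div_mul_eq_div, div_le_iff₀ (by linarith)]
  nlinarith

/-- Expected value of `f` on the final random set, starting from `S`. -/
noncomputable def finalVal {T : Type*} [Fintype T] [DecidableEq T] (f : Finset T → ℝ) :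
    DTree T → Finset T → ℝ
  | .leaf, S => f S
  | .node μ c, S => ∑ i, ∑ r, μ i * μ r * finalVal f (c i) (S ∪ {r})

lemma alg_contract {T : Type*} [Fintype T] [DecidableEq T] (f : Finset T → ℝ)
    (𝒯 : DTree T) : 𝒯.valid → ∀ S, alg 𝒯 (contract f S) = finalVal f 𝒯 S - f S := by
  induction 𝒯 with
  | leaf => intro _ S; simp [alg, finalVal]
  | node μ c ih =>
    intro h S
    obtain ⟨h0, h1, hc⟩ := h
    have hcc : ∀ r, contract (contract f S) {r} = contract f (S ∪ {r}) := by
      intro r; funext A; simp only [contract, Finset.union_assoc]; ring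
    have h2 : ∑ i, ∑ r, μ i * μ r * f S = f S := by
      simp_rw [← Finset.sum_mul, ← Finset.mul_sum, h1]; simp [h1]
    simp only [alg, finalVal, hcc]
    conv_rhs => rw [← h2]
    rw [← Finset.sum_sub_distrib]
    refine Finset.sum_congr rfl fun i _ => ?_
    rw [← Finset.sum_sub_distrib]
    refine Finset.sum_congr rfl fun r _ => ?_
    rw [ih i (hc i)]
    simp only [contract]; ring

lemma alg_eq_finalVal {T : Type*} [Fintype T] [DecidableEq T] (f : Finset T → ℝ)
    (hf : f ∅ = 0) (𝒯 : DTree T) (h : 𝒯.valid) : alg 𝒯 f = finalVal f 𝒯 ∅ := by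
  have := alg_contract f 𝒯 h ∅
  have h2 : contract f ∅ = f := by funext A; simp [contract, hf]
  rw [h2, hf, sub_zero] at this
  exact this

lemma finalVal_mono {T : Type*} [Fintype T] [DecidableEq T] {f g : Finset T → ℝ}
    (hfg : ∀ A, f A ≤ g A) (𝒯 : DTree T) :
    𝒯.valid → ∀ S, finalVal f 𝒯 S ≤ finalVal g 𝒯 S := by
  induction 𝒯 with
  | leaf => intro _ S; exact hfg S
  | node μ c ih =>
    intro h S
    simp only [finalVal]
    exact Finset.sum_le_sum fun i _ => Finset.sum_le_sum fun r _ =>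
      mul_le_mul_of_nonneg_left (ih i (h.2.2 i) _) (mul_nonneg (h.1 i) (h.1 r))

lemma finalVal_linear {T ι : Type*} [Fintype T] [DecidableEq T] (J : Finset ι) (a : ℝ)
    (b : ι → ℝ) (f : ι → Finset T → ℝ) (𝒯 : DTree T) :
    ∀ S, finalVal (fun A => a * ∑ j ∈ J, b j * f j A) 𝒯 S
      = a * ∑ j ∈ J, b j * finalVal (f j) 𝒯 S := by
  induction 𝒯 with
  | leaf => intro S; rfl
  | node μ c ih =>
    intro S
    simp only [finalVal, ih]
    simp only [Finset.mul_sum]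
    symm
    rw [Finset.sum_comm]
    refine Finset.sum_congr rfl fun i _ => ?_
    rw [Finset.sum_comm]
    refine Finset.sum_congr rfl fun r _ => Finset.sum_congr rfl fun j _ => ?_
    ring

/-- Lemma 4.4: the random-walk non-adaptive value for the weighted rank function
is at least `1/(16 log₂ k)` times the weighted sum of the non-adaptive values of
the unweighted class rank functions, summed over the occupied weight classes. -/
theorem nonadaptive_weighted_vs_classes
    {T : Type*} [Fintype T] [DecidableEq T]
    (k : ℕ) (hk : 2 ≤ k) (F : Finset (Finset T))
    (hdc : DownwardClosed F) (hext : KExtendible k F)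
    (w : T → ℝ) (hw : ∀ t, 0 < w t)
    (J : Finset ℤ)
    (hJ : ∀ j : ℤ, j ∈ J ↔ ∃ t : T, (2:ℝ)^(j-1) < w t ∧ w t ≤ (2:ℝ)^j)
    (𝒯 : DTree T) (h𝒯 : 𝒯.valid) :
    alg 𝒯 (wrank F w) ≥
      (1 / (16 * Real.logb 2 k)) * ∑ j ∈ J, (2:ℝ)^j * alg 𝒯 (classRank F w j) := by
  have hc0 : ∀ j, classRank F w j ∅ = 0 := by
    intro j; simp [classRank]
  have hw0 : wrank F w ∅ = 0 := by
    have hF : F.Nonempty := ⟨∅, hdc.1⟩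
    simp [wrank, hF]
  rw [ge_iff_le, alg_eq_finalVal _ hw0 𝒯 h𝒯]
  simp_rw [alg_eq_finalVal _ (hc0 _) 𝒯 h𝒯]
  rw [← finalVal_linear]
  exact finalVal_mono (fun A => pointwise_aux k hk F hdc hext w J A) 𝒯 h𝒯 ∅
end
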